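/- arXiv:2509.14876 — 12 statements merged into one kernel-verified Lean document; each statement's English description precedes it below -/
import Mathlib

section
/- Assume k and c are differentiable on [0,∞), take values k(t) > 0 and c(t) ≥ 0, satisfy the Ramsey dynamics k'(t) = f(k(t)) − (δ + n(t))·k(t) − c(t) and c'(t) = σ·c(t)·(f'(k(t)) − ρ − δ − n(t)), and converge: k(t) → k_∞ with k_∞ > 0 and c(t) → c_∞ as t → ∞. Then c_∞ = f(k_∞) − (δ + n_∞)·k_∞, and exactly one of the following two cases holds: (I) c_∞ = 0 and f(k_∞) = (δ + n_∞)·k_∞; (II) f'(k_∞) = ρ + δ + n_∞. -/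
open Set Filter Real

theorem deriv_lim_zero (g g' : ℝ → ℝ) (L M : ℝ)
    (hg : ∀ t ≥ (0:ℝ), HasDerivAt g (g' t) t)
    (hL : Tendsto g atTop (nhds L)) (hM : Tendsto g' atTop (nhds M)) : M = 0 := by
  have h : ∀ t : ℝ, ∃ s, t ≤ s ∧ (0 ≤ t → g' s = g (t+1) - g t) := by
    intro t
    by_cases ht : 0 ≤ t
    · obtain ⟨s, hs, he⟩ := exists_hasDerivAt_eq_slope g g' (show t < t+1 by linarith)
        (fun x hx => (hg x (by linarith [hx.1])).continuousAt.continuousWithinAt)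
        (fun x hx => hg x (by linarith [hx.1]))
      refine ⟨s, hs.1.le, fun _ => ?_⟩
      rw [he]; simp
    · exact ⟨t, le_rfl, fun h => absurd h ht⟩
  choose s hs he using h
  have h1 : Tendsto (fun t => g' (s t)) atTop (nhds M) :=
    hM.comp (tendsto_atTop_mono hs tendsto_id)
  have h2 : Tendsto (fun t => g (t+1) - g t) atTop (nhds (L - L)) :=
    (hL.comp (tendsto_atTop_add_const_right _ 1 tendsto_id)).sub hL
  rw [sub_self] at h2
  refine tendsto_nhds_unique (h1.congr' ?_) h2
  filter_upwards [eventually_ge_atTop 0] with t ht using he t ht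

/-- Limiting behavior of the Ramsey model with time-varying population growth rate:
if capital and consumption converge, then `c_∞ = f(k_∞) − (δ + n_∞) k_∞` and
exactly one of the two steady-state cases (I) and (II) occurs. -/
theorem ramsey_limiting_behavior
    (f f' : ℝ → ℝ)
    (hf_deriv : ∀ x ∈ Ioi (0:ℝ), HasDerivAt f (f' x) x)
    (hf'_cont : ContinuousOn f' (Ioi 0))
    (hf_mono : StrictMonoOn f (Ioi 0))
    (hf_concave : StrictConcaveOn ℝ (Ici 0) f)
    (hf_cont0 : ContinuousWithinAt f (Ici 0) 0)
    (hf0 : f 0 ≥ 0)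
    (ρ δ σ : ℝ) (hρ : ρ > 0) (hδ : δ > 0) (hσ : σ > 0)
    (n : ℝ → ℝ) (hn_cont : ContinuousOn n (Ici 0))
    (n_inf : ℝ) (hn_lim : Tendsto n atTop (nhds n_inf))
    (hδn : δ + n_inf > 0)
    (k c : ℝ → ℝ)
    (hk_pos : ∀ t ≥ (0:ℝ), k t > 0)
    (hc_nonneg : ∀ t ≥ (0:ℝ), c t ≥ 0)
    (hk_ode : ∀ t ≥ (0:ℝ), HasDerivAt k (f (k t) - (δ + n t) * k t - c t) t)
    (hc_ode : ∀ t ≥ (0:ℝ), HasDerivAt c (σ * c t * (f' (k t) - ρ - δ - n t)) t)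
    (k_inf c_inf : ℝ) (hk_inf_pos : k_inf > 0)
    (hk_lim : Tendsto k atTop (nhds k_inf))
    (hc_lim : Tendsto c atTop (nhds c_inf)) :
    c_inf = f k_inf - (δ + n_inf) * k_inf ∧
    Xor' (c_inf = 0 ∧ f k_inf = (δ + n_inf) * k_inf)
         (f' k_inf = ρ + δ + n_inf) := by
  have hfk : Tendsto (fun t => f (k t)) atTop (nhds (f k_inf)) :=
    (hf_deriv k_inf hk_inf_pos).continuousAt.tendsto.comp hk_lim
  have hf'k : Tendsto (fun t => f' (k t)) atTop (nhds (f' k_inf)) :=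
    (hf'_cont.continuousAt (Ioi_mem_nhds hk_inf_pos)).tendsto.comp hk_lim
  have e1 := deriv_lim_zero k _ _ _ hk_ode hk_lim
    ((hfk.sub ((hn_lim.const_add δ).mul hk_lim)).sub hc_lim)
  have e2 := deriv_lim_zero c _ _ _ hc_ode hc_lim
    ((hc_lim.const_mul σ).mul (((hf'k.sub_const ρ).sub_const δ).sub hn_lim))
  have hs := hf_concave.lt_slope_of_hasDerivAt (self_mem_Ici)
    (mem_Ici.2 hk_inf_pos.le) hk_inf_pos (hf_deriv k_inf hk_inf_pos)
  rw [slope_def_field, sub_zero, lt_div_iff₀ hk_inf_pos] at hs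
  refine ⟨by linarith, ?_⟩
  by_cases hII : f' k_inf = ρ + δ + n_inf
  · refine Or.inr ⟨hII, fun hI => ?_⟩
    have := hI.2
    rw [hII] at hs
    nlinarith [mul_pos hρ hk_inf_pos]
  · refine Or.inl ⟨?_, hII⟩
    have hc : c_inf = 0 := by
      rcases mul_eq_zero.1 e2 with h | h
      · exact (mul_eq_zero.1 h).resolve_left hσ.ne'
      · exact absurd (by linarith) hII
    exact ⟨hc, by linarith⟩
end

section
/- Let k_∞ > 0 with f(k_∞) > 0, set z_∞ = k_∞ / f(k_∞), and let x_∞ > 0 satisfy the steady-state equations of the consumption-to-capital ratio system: 0 = (1 − f'(k_∞)·z_∞)·(1/z_∞ − (δ + n_∞) − x_∞) and 0 = (σ·f'(k_∞) − 1/z_∞) + (1 − σ)·(δ + n_∞) − σ·ρ + x_∞. Then x_∞ = f(k_∞)/k_∞ − δ − n_∞ and x_∞ > ρ; that is, the steady-state consumption-to-capital ratio exceeds the discount rate. -/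
open Set Filter Real

/-- At the steady state of the consumption-to-capital ratio system of the Ramsey
model, the ratio `x_∞` equals `f(k_∞)/k_∞ − δ − n_∞` and exceeds the discount rate `ρ`. -/
theorem consumption_to_capital_ratio_exceeds_discount
    (f f' : ℝ → ℝ)
    (hf_deriv : ∀ x ∈ Ioi (0:ℝ), HasDerivAt f (f' x) x)
    (hf'_cont : ContinuousOn f' (Ioi 0))
    (hf_mono : StrictMonoOn f (Ioi 0))
    (hf_concave : StrictConcaveOn ℝ (Ici 0) f)
    (hf_cont0 : ContinuousWithinAt f (Ici 0) 0)
    (hf0 : f 0 ≥ 0)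
    (ρ δ σ : ℝ) (hρ : ρ > 0) (hδ : δ > 0) (hσ : σ > 0)
    (n_inf : ℝ)
    (k_inf : ℝ) (hk_inf : k_inf > 0) (hfk_inf : f k_inf > 0)
    (z_inf : ℝ) (hz_def : z_inf = k_inf / f k_inf)
    (x_inf : ℝ) (hx_pos : x_inf > 0)
    (h_steady1 : 0 = (1 - f' k_inf * z_inf) * (1 / z_inf - (δ + n_inf) - x_inf))
    (h_steady2 : 0 = (σ * f' k_inf - 1 / z_inf) + (1 - σ) * (δ + n_inf) - σ * ρ + x_inf) :
    x_inf = f k_inf / k_inf - δ - n_inf ∧ x_inf > ρ := by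
  have h1 : f' k_inf < slope f 0 k_inf :=
    hf_concave.lt_slope_of_hasDerivAt (mem_Ici.2 le_rfl) (mem_Ici.2 hk_inf.le) hk_inf
      (hf_deriv k_inf hk_inf)
  rw [slope_def_field, sub_zero] at h1
  have h2 : f' k_inf < f k_inf / k_inf :=
    lt_of_lt_of_le h1 (by gcongr; linarith)
  have hz : 1 / z_inf = f k_inf / k_inf := by rw [hz_def, one_div_div]
  have hne : 1 - f' k_inf * z_inf ≠ 0 := by
    have h3 : f' k_inf * z_inf < 1 := by
      rw [lt_div_iff₀ hk_inf] at h2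
      rw [hz_def, ← mul_div_assoc, div_lt_one hfk_inf]
      exact h2
    linarith
  have h4 := (mul_eq_zero.1 h_steady1.symm).resolve_left hne
  rw [hz] at h4 h_steady2
  have h5 : σ * (f' k_inf - (δ + n_inf) - ρ) = 0 := by linarith
  have h6 := (mul_eq_zero.1 h5).resolve_left hσ.ne'
  constructor <;> linarith
end

section
/- Let ρ, δ, r > 0 with δ > r, and suppose k₁, k₂ > 0 satisfy f'(k₁) = ρ + δ − r and f'(k₂) = ρ + δ. Then k₁ > k₂, and the steady-state consumptions satisfy D_c := (f(k₁) − (δ − r)·k₁) − (f(k₂) − δ·k₂) ≥ ρ·(k₁ − k₂) + r·k₂ > 0. In particular, the equilibrium consumption per labour is strictly higher when the population diminishes (limiting growth rate −r) than when it stagnates (limiting growth rate 0). -/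
open Set Filter Real

/-- Comparison of equilibrium consumption per labour in the Ramsey model with Allee effect:
the steady-state consumption is strictly higher under a diminishing population
(limiting growth rate `−r`) than under a stagnating one (limiting growth rate `0`). -/
theorem equilibrium_consumption_comparison
    (f f' : ℝ → ℝ)
    (hf_deriv : ∀ x ∈ Ioi (0:ℝ), HasDerivAt f (f' x) x)
    (hf'_anti : StrictAntiOn f' (Ioi 0))
    (ρ δ r : ℝ) (hρ : ρ > 0) (hr : r > 0) (hδr : δ > r)
    (k₁ k₂ : ℝ) (hk₁ : k₁ > 0) (hk₂ : k₂ > 0)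
    (hfk₁ : f' k₁ = ρ + δ - r) (hfk₂ : f' k₂ = ρ + δ) :
    k₁ > k₂ ∧
    (f k₁ - (δ - r) * k₁) - (f k₂ - δ * k₂) ≥ ρ * (k₁ - k₂) + r * k₂ ∧
    ρ * (k₁ - k₂) + r * k₂ > 0 := by
  have h : k₂ < k₁ := by
    by_contra hc
    have := hf'_anti.antitoneOn (mem_Ioi.2 hk₁) (mem_Ioi.2 hk₂) (not_lt.1 hc)
    linarith
  obtain ⟨c, hc, hce⟩ := exists_hasDerivAt_eq_slope f f' h
    (fun x hx => (hf_deriv x (lt_of_lt_of_le hk₂ hx.1)).continuousAt.continuousWithinAt)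
    (fun x hx => hf_deriv x (lt_trans hk₂ hx.1))
  have h1 : f' k₁ < f' c := hf'_anti (mem_Ioi.2 (lt_trans hk₂ hc.1)) (mem_Ioi.2 hk₁) hc.2
  have hpos : 0 < k₁ - k₂ := sub_pos.2 h
  rw [hce, hfk₁, lt_div_iff₀ hpos] at h1
  refine ⟨h, ?_, ?_⟩
  · nlinarith
  · have := mul_pos hρ hpos
    have := mul_pos hr hk₂
    linarith
end

section
/- Let f : [0,∞) → ℝ be continuous, strictly concave, with f(0) ≥ 0, and differentiable on (0,∞). Let ρ > 0 and a ∈ ℝ. Then there is no k > 0 satisfying both f(k) = a·k and f'(k) = ρ + a; that is, in the limiting equation [f(k) − a·k]·[f'(k) − ρ − a] = 0 with a = δ + n_∞ the two factors cannot vanish simultaneously. -/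
open Set Filter Real

/-- In the limiting equation `[f(k) − a·k]·[f'(k) − ρ − a] = 0` of the Ramsey model,
the two factors cannot vanish simultaneously: there is no `k > 0` with both
`f(k) = a·k` and `f'(k) = ρ + a`, provided `ρ > 0` and `f` is strictly concave with `f(0) ≥ 0`. -/
theorem no_simultaneous_vanishing
    (f : ℝ → ℝ)
    (hf_cont : ContinuousOn f (Ici 0))
    (hf_concave : StrictConcaveOn ℝ (Ici 0) f)
    (hf0 : f 0 ≥ 0)
    (hf_diff : ∀ k ∈ Ioi (0:ℝ), DifferentiableAt ℝ f k)
    (ρ a : ℝ) (hρ : ρ > 0) :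
    ¬ ∃ k > (0:ℝ), f k = a * k ∧ deriv f k = ρ + a := by
  rintro ⟨k, hk, h1, h2⟩
  have h := hf_concave.concaveOn.deriv_le_slope (x := 0) (y := k)
    (mem_Ici.2 le_rfl) (mem_Ici.2 hk.le) hk (hf_diff k hk)
  rw [slope_def_field, sub_zero, le_div_iff₀ hk, h1, h2] at h
  nlinarith [mul_pos hρ hk]
end

section
/- Let f : ℝ → ℝ be locally Lipschitz, nondecreasing, with f(x) ≥ 0 for x ≥ 0; let δ ∈ ℝ and let n, c : [0,∞) → ℝ be continuous. Suppose k, k¹, k² : [0,∞) → ℝ are differentiable with k'(t) = f(k(t)) − (δ + n(t))·k(t) − c(t), (k¹)'(t) = −(δ + n(t))·k¹(t), (k²)'(t) = f(k²(t)) − (δ + n(t))·k²(t), common initial value k(0) = k¹(0) = k²(0) = k₀ ≥ 0, and 0 ≤ c(t) ≤ f(k(t)) for all t ≥ 0. Then k¹(t) ≤ k(t) ≤ k²(t) for all t ≥ 0. -/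
open Set Filter Real

lemma aux_comparison (w w' : ℝ → ℝ) (T K : ℝ)
    (hw : ∀ t ≥ (0:ℝ), HasDerivAt w (w' t) t) (h0 : w 0 = 0)
    (h : ∀ t ∈ Icc 0 T, 0 < w t → w' t ≤ K * w t) : ∀ t ∈ Icc 0 T, w t ≤ 0 := by
  intro t ht
  have key : ∀ ε > (0:ℝ), w t ≤ ε * Real.exp ((K+1) * t) := by
    intro ε hε
    have hB : ∀ x : ℝ, HasDerivAt (fun x => ε * Real.exp ((K+1) * x))
        (ε * (Real.exp ((K+1) * x) * ((K+1) * 1))) x := fun x =>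
      (((hasDerivAt_id x).const_mul (K+1)).exp).const_mul ε
    refine image_le_of_deriv_right_lt_deriv_boundary (a := 0) (b := T) (f := w) (f' := w')
      (fun x hx => (hw x hx.1).continuousAt.continuousWithinAt)
      (fun x hx => (hw x hx.1).hasDerivWithinAt) ?_ hB ?_ ht
    · simp [h0, hε.le]
    · intro x hx hxe
      have hp : 0 < ε * Real.exp ((K+1) * x) := by positivity
      have := h x ⟨hx.1, hx.2.le⟩ (by rw [hxe]; exact hp)
      rw [hxe] at this
      nlinarith
  have hE := Real.exp_pos ((K+1) * t)
  refine le_of_forall_pos_le_add fun e he => ?_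
  have := key (e / Real.exp ((K+1) * t)) (by positivity)
  rw [div_mul_cancel₀ _ hE.ne'] at this
  linarith

/-- Bounds for the capital per labour in the Ramsey model: the solution `k` of the Ramsey
dynamics is squeezed between the solution `k¹` of the pure-depreciation dynamics
(all output consumed) and the solution `k²` of the Solow–Swan dynamics (zero consumption). -/
theorem capital_bounds
    (f : ℝ → ℝ)
    (hf_lip : LocallyLipschitz f)
    (hf_mono : Monotone f)
    (hf_nonneg : ∀ x ≥ (0:ℝ), f x ≥ 0)
    (δ : ℝ)
    (n c : ℝ → ℝ)
    (hn_cont : ContinuousOn n (Ici 0))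
    (hc_cont : ContinuousOn c (Ici 0))
    (k k₁ k₂ : ℝ → ℝ)
    (hk_ode : ∀ t ≥ (0:ℝ), HasDerivAt k (f (k t) - (δ + n t) * k t - c t) t)
    (hk₁_ode : ∀ t ≥ (0:ℝ), HasDerivAt k₁ (-(δ + n t) * k₁ t) t)
    (hk₂_ode : ∀ t ≥ (0:ℝ), HasDerivAt k₂ (f (k₂ t) - (δ + n t) * k₂ t) t)
    (k₀ : ℝ) (hk₀ : k₀ ≥ 0)
    (hk_init : k 0 = k₀) (hk₁_init : k₁ 0 = k₀) (hk₂_init : k₂ 0 = k₀)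
    (hc_bounds : ∀ t ≥ (0:ℝ), 0 ≤ c t ∧ c t ≤ f (k t)) :
    ∀ t ≥ (0:ℝ), k₁ t ≤ k t ∧ k t ≤ k₂ t := by
  intro T hT
  have hmem : T ∈ Icc (0:ℝ) T := ⟨hT, le_rfl⟩
  obtain ⟨M, hM⟩ := isCompact_Icc.exists_bound_of_continuousOn (s := Icc (0:ℝ) T)
    (f := fun t => δ + n t) (continuousOn_const.add (hn_cont.mono Icc_subset_Ici_self))
  constructor
  · have := aux_comparison (fun t => k₁ t - k t) _ T M
      (fun t ht => (hk₁_ode t ht).sub (hk_ode t ht)) (by simp [hk_init, hk₁_init]) ?_ T hmem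
    · simpa using this
    · intro t ht hp
      have h1 := abs_le.1 (hM t ht)
      have h2 := (hc_bounds t ht.1).2
      nlinarith [mul_nonneg (by linarith [h1.1] : 0 ≤ M + (δ + n t)) hp.le]
  · have hkc : ContinuousOn k (Icc 0 T) := fun x hx =>
      (hk_ode x hx.1).continuousAt.continuousWithinAt
    have hkc2 : ContinuousOn k₂ (Icc 0 T) := fun x hx =>
      (hk₂_ode x hx.1).continuousAt.continuousWithinAt
    have hS : IsCompact (k '' Icc 0 T ∪ k₂ '' Icc 0 T) :=
      (isCompact_Icc.image_of_continuousOn hkc).union (isCompact_Icc.image_of_continuousOn hkc2)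
    obtain ⟨L, hL⟩ := (hf_lip.locallyLipschitzOn (s := k '' Icc 0 T ∪ k₂ '' Icc 0 T)).exists_lipschitzOnWith_of_compact hS
    have := aux_comparison (fun t => k t - k₂ t) _ T (L + M)
      (fun t ht => (hk_ode t ht).sub (hk₂_ode t ht)) (by simp [hk_init, hk₂_init]) ?_ T hmem
    · simpa using this
    · intro t ht hp
      have h1 := abs_le.1 (hM t ht)
      have h2 := (hc_bounds t ht.1).1
      have h3 := hL.dist_le_mul (k t) (Or.inl ⟨t, ht, rfl⟩) (k₂ t) (Or.inr ⟨t, ht, rfl⟩)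
      rw [Real.dist_eq, Real.dist_eq, abs_of_pos hp] at h3
      have h4 := (le_abs_self _).trans h3
      nlinarith [mul_nonneg (by linarith [h1.1] : 0 ≤ M + (δ + n t)) hp.le]
end

section
/- If 0 < L₀ < N, then for all t ≥ 0: 0 < L(t) < N and L is strictly decreasing with L(t) → 0 as t → ∞; moreover −r < n(t) < 0 for all t ≥ 0, n is strictly decreasing, and n(t) → −r as t → ∞. -/
open Set Filter Real

lemma pos_of_lin (y g : ℝ → ℝ) (hg : ContinuousOn g (Ici 0)) (h0 : 0 < y 0)
    (hy : ∀ t ≥ (0:ℝ), HasDerivAt y (g t * y t) t) : ∀ t ≥ (0:ℝ), 0 < y t := by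
  have hk : Continuous (fun s : ℝ => g (max s 0)) :=
    hg.comp_continuous (by fun_prop) (fun s => le_max_right s 0)
  set G : ℝ → ℝ := fun t => ∫ s in (0:ℝ)..t, g (max s 0) with hG
  have hGd : ∀ t, HasDerivAt G (g (max t 0)) t := fun t =>
    intervalIntegral.integral_hasDerivAt_right (hk.intervalIntegrable _ _)
      (hk.stronglyMeasurableAtFilter _ _) hk.continuousAt
  have hd : ∀ t ≥ (0:ℝ), HasDerivAt (fun t => y t * exp (-G t)) 0 t := by
    intro t ht
    have h := (hy t ht).mul ((hGd t).neg.exp)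
    rw [max_eq_left ht] at h
    refine HasDerivAt.congr_deriv (h) ?_
    ring
  intro t ht
  have hc := constant_of_has_deriv_right_zero (f := fun t => y t * exp (-G t)) (a := 0) (b := t)
    (fun s hs => (hd s hs.1).continuousAt.continuousWithinAt)
    (fun s hs => (hd s hs.1).hasDerivWithinAt) t ⟨ht, le_refl _⟩
  have hp : 0 < y t * exp (-G t) := by
    have : y t * exp (-G t) = y 0 * exp (-G 0) := hc
    rw [this]; positivity
  exact pos_of_mul_pos_left hp (exp_pos _).le

/-- Allee-effect population dynamics below the critical threshold: if `0 < L₀ < N`, then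
the labour force stays in `(0,N)`, strictly decreases and tends to `0`; the growth rate
`n(t) = r·(1 − L/M)·(L/N − 1)` satisfies `−r < n(t) < 0`, is strictly decreasing and
tends to `−r`. -/
theorem allee_below_threshold
    (r N M : ℝ) (hr : r > 0) (hN : 0 < N) (hNM : N < M)
    (L : ℝ → ℝ) (L₀ : ℝ) (hL₀_pos : 0 < L₀) (hL₀ : L₀ < N)
    (hL_init : L 0 = L₀)
    (hL_ode : ∀ t ≥ (0:ℝ),
      HasDerivAt L (r * L t * (1 - L t / M) * (L t / N - 1)) t)
    (n : ℝ → ℝ)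
    (hn_def : ∀ t, n t = r * (1 - L t / M) * (L t / N - 1)) :
    (∀ t ≥ (0:ℝ), 0 < L t ∧ L t < N) ∧
    StrictAntiOn L (Ici 0) ∧
    Tendsto L atTop (nhds 0) ∧
    (∀ t ≥ (0:ℝ), -r < n t ∧ n t < 0) ∧
    StrictAntiOn n (Ici 0) ∧
    Tendsto n atTop (nhds (-r)) := by
  have hM : 0 < M := hN.trans hNM
  have hLc : ContinuousOn L (Ici 0) := fun s hs => (hL_ode s hs).continuousAt.continuousWithinAt
  have hpos : ∀ t ≥ (0:ℝ), 0 < L t := by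
    apply pos_of_lin L (fun t => r * (1 - L t / M) * (L t / N - 1)) (by fun_prop) (by linarith)
    intro t ht
    refine HasDerivAt.congr_deriv (hL_ode t ht) ?_
    ring
  have hlt : ∀ t ≥ (0:ℝ), 0 < N - L t := by
    apply pos_of_lin (fun t => N - L t) (fun t => r * L t * (1 - L t / M) / N) (by fun_prop)
      (by linarith)
    intro t ht
    refine HasDerivAt.congr_deriv ((hL_ode t ht).const_sub N) ?_
    field_simp
    ring
  have hu : ∀ t ≥ (0:ℝ), 0 < 1 - L t / M := fun t ht => by
    rw [sub_pos, div_lt_one hM]; linarith [hlt t ht]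
  have hv : ∀ t ≥ (0:ℝ), 0 < 1 - L t / N := fun t ht => by
    rw [sub_pos, div_lt_one hN]; linarith [hlt t ht]
  have hanti : StrictAntiOn L (Ici 0) := by
    apply strictAntiOn_of_deriv_neg (convex_Ici 0) hLc
    intro t ht
    rw [interior_Ici] at ht
    have ht' : t ≥ 0 := le_of_lt ht
    rw [(hL_ode t ht').deriv]
    have := mul_pos (mul_pos (mul_pos hr (hpos t ht')) (hu t ht')) (hv t ht')
    linarith
  set c : ℝ := r * (1 - L 0 / M) * (1 - L 0 / N) with hc
  have hcpos : 0 < c := mul_pos (mul_pos hr (hu 0 le_rfl)) (hv 0 le_rfl)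
  have hnc : ∀ t ≥ (0:ℝ), c ≤ r * (1 - L t / M) * (1 - L t / N) := by
    intro t ht
    have hle : L t ≤ L 0 := hanti.antitoneOn (mem_Ici.2 le_rfl) ht ht
    have h1 := hu 0 le_rfl
    have h2 := hv 0 le_rfl
    have h3 := hu t ht
    rw [hc]
    gcongr
  have hbd : ∀ t ≥ (0:ℝ), L t ≤ L 0 * exp (-(c * t)) := by
    have hd : ∀ t ≥ (0:ℝ), HasDerivAt (fun t => L t * exp (c * t))
        ((c - r * (1 - L t / M) * (1 - L t / N)) * (L t * exp (c * t))) t := by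
      intro t ht
      have h := (hL_ode t ht).mul (((hasDerivAt_id t).const_mul c).exp)
      refine HasDerivAt.congr_deriv (h) ?_
      simp only [id, mul_one]
      ring
    have ha : AntitoneOn (fun t => L t * exp (c * t)) (Ici 0) := by
      apply antitoneOn_of_deriv_nonpos (convex_Ici 0) (by fun_prop)
      · intro t ht
        rw [interior_Ici] at ht
        exact (hd t (le_of_lt ht)).differentiableAt.differentiableWithinAt
      · intro t ht
        rw [interior_Ici] at ht
        have ht' : t ≥ 0 := le_of_lt ht
        rw [(hd t ht').deriv]
        exact mul_nonpos_of_nonpos_of_nonneg (by linarith [hnc t ht'])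
          (mul_pos (hpos t ht') (exp_pos _)).le
    intro t ht
    have h : L t * exp (c * t) ≤ L 0 * exp (c * 0) := ha (mem_Ici.2 le_rfl) ht ht
    rw [mul_zero, exp_zero, mul_one] at h
    rw [exp_neg, ← div_eq_mul_inv, le_div_iff₀ (exp_pos _)]
    exact h
  have hlim : Tendsto L atTop (nhds 0) := by
    have h1 : Tendsto (fun t : ℝ => L 0 * exp (-(c * t))) atTop (nhds 0) := by
      have := (tendsto_exp_neg_atTop_nhds_zero.comp
        (tendsto_id.const_mul_atTop hcpos)).const_mul (L 0)
      simpa [Function.comp_def] using this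
    refine tendsto_of_tendsto_of_tendsto_of_le_of_le' tendsto_const_nhds h1 ?_ ?_
    · filter_upwards [eventually_ge_atTop 0] with t ht using (hpos t ht).le
    · filter_upwards [eventually_ge_atTop 0] with t ht using hbd t ht
  refine ⟨fun t ht => ⟨hpos t ht, by linarith [hlt t ht]⟩, hanti, hlim, ?_, ?_, ?_⟩
  · intro t ht
    have h1 := hu t ht
    have h2 := hv t ht
    have h3 := div_pos (hpos t ht) hM
    have h4 := div_pos (hpos t ht) hN
    have h5 : (1 - L t / M) * (1 - L t / N) < 1 := by nlinarith
    have h6 := mul_pos h1 h2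
    rw [hn_def]
    constructor <;> nlinarith
  · intro s hs t ht hst
    have h := hanti hs ht hst
    have h1 := hu s hs
    have h2 := hv s hs
    have h3 : 1 - L s / M < 1 - L t / M := by gcongr
    have h4 : 1 - L s / N < 1 - L t / N := by gcongr
    have h5 := mul_lt_mul'' h3 h4 h1.le h2.le
    rw [hn_def, hn_def]
    nlinarith
  · have hf : n = fun t => r * (1 - L t / M) * (L t / N - 1) := funext hn_def
    rw [hf]
    have := (((hlim.div_const M).const_sub 1).const_mul r).mul ((hlim.div_const N).sub_const 1)
    simpa using this
end

section
/- If N < L₀ < M, then for all t ≥ 0: N < L(t) < M, n(t) > 0, L is strictly increasing with L(t) → M as t → ∞, and n(t) → 0 as t → ∞. Moreover, if (N+M)/2 < L₀ < M then n(t) ≤ n(0) for all t ≥ 0. -/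
open Set Filter Real

theorem allee_aux_pos (y a : ℝ → ℝ) (ha : ContinuousOn a (Ici 0))
    (h : ∀ t ≥ (0:ℝ), HasDerivAt y (a t * y t) t) (h0 : 0 < y 0) :
    ∀ t ≥ (0:ℝ), 0 < y t := by
  let b : ℝ → ℝ := fun t => a (max t 0)
  have hb : Continuous b :=
    ha.comp_continuous (by fun_prop) (fun t => le_max_right t 0)
  have hA : ∀ t, HasDerivAt (fun u => ∫ s in (0:ℝ)..u, b s) (b t) t := fun t =>
    intervalIntegral.integral_hasDerivAt_right (hb.intervalIntegrable _ _)
      (hb.stronglyMeasurableAtFilter _ _) hb.continuousAt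
  have hd : ∀ t ≥ (0:ℝ),
      HasDerivAt (fun u => y u * Real.exp (-∫ s in (0:ℝ)..u, b s)) 0 t := by
    intro t ht
    have h1 := (h t ht).mul (hA t).neg.exp
    have hbt : b t = a t := by simp only [b]; rw [max_eq_left ht]
    refine HasDerivAt.congr_deriv h1 ?_
    rw [hbt]
    simp only [Pi.neg_apply]
    ring
  intro t ht
  have hc := constant_of_has_deriv_right_zero
    (f := fun u => y u * Real.exp (-∫ s in (0:ℝ)..u, b s)) (a := 0) (b := t)
    (fun u hu => (hd u hu.1).continuousAt.continuousWithinAt)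
    (fun u hu => (hd u hu.1).hasDerivWithinAt) t ⟨ht, le_refl t⟩
  simp only [intervalIntegral.integral_same, neg_zero, Real.exp_zero, mul_one] at hc
  have h2 : 0 < y t * Real.exp (-∫ s in (0:ℝ)..t, b s) := by rw [hc]; exact h0
  exact pos_of_mul_pos_left h2 (Real.exp_pos _).le

/-- Allee-effect population dynamics between threshold and carrying capacity: if
`N < L₀ < M`, the labour force stays in `(N,M)`, strictly increases and tends to `M`;
the growth rate `n` is positive and tends to `0`; if moreover `(N+M)/2 < L₀`, then
`n(t) ≤ n(0)` for all `t ≥ 0`. -/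
theorem allee_between_threshold_and_capacity
    (r N M : ℝ) (hr : r > 0) (hN : 0 < N) (hNM : N < M)
    (L : ℝ → ℝ) (L₀ : ℝ) (hL₀_lb : N < L₀) (hL₀_ub : L₀ < M)
    (hL_init : L 0 = L₀)
    (hL_ode : ∀ t ≥ (0:ℝ),
      HasDerivAt L (r * L t * (1 - L t / M) * (L t / N - 1)) t)
    (n : ℝ → ℝ)
    (hn_def : ∀ t, n t = r * (1 - L t / M) * (L t / N - 1)) :
    (∀ t ≥ (0:ℝ), N < L t ∧ L t < M) ∧
    (∀ t ≥ (0:ℝ), n t > 0) ∧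
    StrictMonoOn L (Ici 0) ∧
    Tendsto L atTop (nhds M) ∧
    Tendsto n atTop (nhds 0) ∧
    ((N + M) / 2 < L₀ → ∀ t ≥ (0:ℝ), n t ≤ n 0) := by
  have hM : 0 < M := hN.trans hNM
  have hcont : ContinuousOn L (Ici 0) := fun t ht =>
    (hL_ode t ht).continuousAt.continuousWithinAt
  have hlo : ∀ t ≥ (0:ℝ), N < L t := by
    intro t ht
    have := allee_aux_pos (fun t => L t - N) (fun t => r * L t * (1 - L t / M) / N)
      (by fun_prop) (fun t ht => by
        refine ((hL_ode t ht).sub_const N).congr_deriv ?_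
        field_simp) (by simp only [hL_init]; linarith) t ht
    linarith
  have hhi : ∀ t ≥ (0:ℝ), L t < M := by
    intro t ht
    have := allee_aux_pos (fun t => M - L t) (fun t => -(r * L t * (L t / N - 1) / M))
      (by fun_prop) (fun t ht => by
        refine ((hL_ode t ht).const_sub M).congr_deriv ?_
        field_simp) (by simp only [hL_init]; linarith) t ht
    linarith
  have hnpos : ∀ t ≥ (0:ℝ), n t > 0 := by
    intro t ht
    rw [hn_def]
    have h1 : 0 < 1 - L t / M := by
      rw [sub_pos, div_lt_one hM]; exact hhi t ht
    have h2 : 0 < L t / N - 1 := by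
      rw [sub_pos, one_lt_div hN]; exact hlo t ht
    positivity
  have hmono : StrictMonoOn L (Ici 0) := by
    apply strictMonoOn_of_deriv_pos (convex_Ici 0) hcont
    intro t ht
    rw [interior_Ici] at ht
    have ht' : t ≥ 0 := le_of_lt ht
    rw [(hL_ode t ht').deriv]
    have h1 := hnpos t ht'
    rw [hn_def] at h1
    have h2 : 0 < L t := hN.trans (hlo t ht')
    have := mul_pos h2 h1
    linarith
  have hge : ∀ t ≥ (0:ℝ), L₀ ≤ L t := by
    intro t ht
    rw [← hL_init]
    exact hmono.monotoneOn (mem_Ici.2 le_rfl) ht ht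
  obtain ⟨c, hc⟩ : ∃ c, c = r * L₀ * (L₀ / N - 1) / M := ⟨_, rfl⟩
  have hk0 : 0 < L₀ / N - 1 := by
    rw [sub_pos, one_lt_div hN]; exact hL₀_lb
  have hL0pos : 0 < L₀ := hN.trans hL₀_lb
  have hcpos : 0 < c := by rw [hc]; positivity
  have hzd : ∀ t ≥ (0:ℝ), HasDerivAt (fun t => (M - L t) * Real.exp (c * t))
      ((M - L t) * Real.exp (c * t) * (c - r * L t * (L t / N - 1) / M)) t := by
    intro t ht
    refine HasDerivAt.congr_deriv
      (((hL_ode t ht).const_sub M).mul (((hasDerivAt_id t).const_mul c).exp)) ?_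
    simp only [id]
    field_simp
    ring
  have hanti : AntitoneOn (fun t => (M - L t) * Real.exp (c * t)) (Ici 0) := by
    apply antitoneOn_of_deriv_nonpos (convex_Ici 0)
    · exact fun t ht => (hzd t ht).continuousAt.continuousWithinAt
    · intro t ht
      rw [interior_Ici] at ht
      exact (hzd t (le_of_lt ht)).differentiableAt.differentiableWithinAt
    · intro t ht
      rw [interior_Ici] at ht
      have ht' : t ≥ 0 := le_of_lt ht
      rw [(hzd t ht').deriv]
      have h1 : 0 < M - L t := sub_pos.2 (hhi t ht')
      have h2 := hge t ht'
      have h3 : c ≤ r * L t * (L t / N - 1) / M := by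
        rw [hc]
        have : 0 < L t := hL0pos.trans_le h2
        gcongr
      exact mul_nonpos_of_nonneg_of_nonpos (by positivity) (by linarith)
  have hlim : Tendsto L atTop (nhds M) := by
    have hexp : Tendsto (fun t => M - (M - L₀) * Real.exp (-(c * t))) atTop (nhds M) := by
      have h1 : Tendsto (fun t => Real.exp (-(c * t))) atTop (nhds 0) :=
        Real.tendsto_exp_neg_atTop_nhds_zero.comp (tendsto_id.const_mul_atTop hcpos)
      simpa using (h1.const_mul (M - L₀)).const_sub M
    refine tendsto_of_tendsto_of_tendsto_of_le_of_le' hexp tendsto_const_nhds ?_ ?_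
    · filter_upwards [eventually_ge_atTop (0:ℝ)] with t ht
      have h1 := hanti (mem_Ici.2 le_rfl) (mem_Ici.2 ht) ht
      simp only [hL_init, mul_zero, Real.exp_zero, mul_one] at h1
      have h2 := mul_le_mul_of_nonneg_right h1 (Real.exp_pos (-(c * t))).le
      rw [mul_assoc, ← Real.exp_add, add_neg_cancel, Real.exp_zero] at h2
      linarith
    · filter_upwards [eventually_ge_atTop (0:ℝ)] with t ht
      exact (hhi t ht).le
  refine ⟨fun t ht => ⟨hlo t ht, hhi t ht⟩, hnpos, hmono, hlim, ?_, ?_⟩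
  · have h1 : Tendsto (fun t => r * (1 - L t / M) * (L t / N - 1)) atTop
        (nhds (r * (1 - M / M) * (M / N - 1))) :=
      (((hlim.div_const M).const_sub 1).const_mul r).mul ((hlim.div_const N).sub_const 1)
    rw [div_self hM.ne'] at h1
    have h2 : n = fun t => r * (1 - L t / M) * (L t / N - 1) := funext hn_def
    rw [h2]
    simpa using h1
  · intro hmid t ht
    rw [hn_def, hn_def, hL_init]
    have h1 := hge t ht
    have h2 : r * (1 - L₀ / M) * (L₀ / N - 1) - r * (1 - L t / M) * (L t / N - 1)
        = r / (M * N) * ((L t - L₀) * (L t + L₀ - M - N)) := by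
      field_simp
      ring
    have h3 : 0 ≤ r / (M * N) * ((L t - L₀) * (L t + L₀ - M - N)) :=
      mul_nonneg (by positivity) (mul_nonneg (by linarith) (by linarith))
    linarith
end

section
/- If L₀ > M, then for all t ≥ 0: L(t) > M and L is strictly decreasing with L(t) → M as t → ∞; moreover n(0) ≤ n(t) < 0 for all t ≥ 0 (with n(0) < n(t) for t > 0), n is strictly increasing, and n(t) → 0 as t → ∞. -/
open Set Filter Real

/-- Allee-effect population dynamics above the carrying capacity: if `L₀ > M`, the labour
force stays above `M`, strictly decreases and tends to `M`; the growth rate `n` satisfies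
`n(0) ≤ n(t) < 0` (with strict inequality `n(0) < n(t)` for `t > 0`), is strictly
increasing, and tends to `0`. -/
theorem allee_above_capacity
    (r N M : ℝ) (hr : r > 0) (hN : 0 < N) (hNM : N < M)
    (L : ℝ → ℝ) (L₀ : ℝ) (hL₀ : L₀ > M)
    (hL_init : L 0 = L₀)
    (hL_ode : ∀ t ≥ (0:ℝ),
      HasDerivAt L (r * L t * (1 - L t / M) * (L t / N - 1)) t)
    (n : ℝ → ℝ)
    (hn_def : ∀ t, n t = r * (1 - L t / M) * (L t / N - 1)) :
    (∀ t ≥ (0:ℝ), L t > M) ∧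
    StrictAntiOn L (Ici 0) ∧
    Tendsto L atTop (nhds M) ∧
    (∀ t ≥ (0:ℝ), n 0 ≤ n t ∧ n t < 0) ∧
    (∀ t > (0:ℝ), n 0 < n t) ∧
    StrictMonoOn n (Ici 0) ∧
    Tendsto n atTop (nhds 0) := by
  have hM : 0 < M := hN.trans hNM
  have hcont : ContinuousOn L (Ici 0) := fun t ht => (hL_ode t ht).continuousAt.continuousWithinAt
  have hne : ∀ T ≥ (0:ℝ), L T ≠ M := by
    intro T hT hLT
    have hc : ContinuousOn L (Icc 0 T) := hcont.mono Icc_subset_Ici_self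
    have hg : ContinuousOn (fun t => r * L t * (L t / N - 1) / M) (Icc 0 T) := by fun_prop
    obtain ⟨K, hK⟩ := (isCompact_Icc.image_of_continuousOn hg).bddAbove
    have hK' : ∀ t ∈ Icc 0 T, r * L t * (L t / N - 1) / M ≤ K := fun t ht =>
      hK (mem_image_of_mem _ ht)
    have hd : ∀ t ≥ (0:ℝ), HasDerivAt (fun t => (L t - M)^2 * Real.exp (2 * K * t))
        (2 * (K - r * L t * (L t / N - 1) / M) * ((L t - M)^2 * Real.exp (2 * K * t))) t := by
      intro t ht
      have h1 := ((hL_ode t ht).sub_const M).pow 2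
      have h2 := (((hasDerivAt_id t).const_mul (2 * K))).exp
      refine (h1.mul h2).congr_deriv ?_
      simp only [id, Pi.pow_apply, Nat.cast_ofNat, mul_one]
      field_simp
      ring
    have hmono : MonotoneOn (fun t => (L t - M)^2 * Real.exp (2 * K * t)) (Icc 0 T) := by
      apply monotoneOn_of_deriv_nonneg (convex_Icc 0 T)
      · exact fun t ht => (hd t ht.1).continuousAt.continuousWithinAt
      · intro t ht
        rw [interior_Icc] at ht
        exact (hd t ht.1.le).differentiableAt.differentiableWithinAt
      · intro t ht
        rw [interior_Icc] at ht
        rw [(hd t ht.1.le).deriv]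
        have := hK' t ⟨ht.1.le, ht.2.le⟩
        have h3 : 0 ≤ K - r * L t * (L t / N - 1) / M := by linarith
        positivity
    have h := hmono (left_mem_Icc.2 hT) (right_mem_Icc.2 hT) hT
    simp only [hLT, hL_init] at h
    have : 0 < (L₀ - M)^2 := pow_pos (by linarith) 2
    simp at h
    linarith
  have hgt : ∀ t ≥ (0:ℝ), L t > M := by
    intro t ht
    by_contra hlt
    have := intermediate_value_Icc' ht (hcont.mono Icc_subset_Ici_self)
    obtain ⟨s, hs, hs'⟩ := this ⟨not_lt.1 hlt, by rw [hL_init]; exact hL₀.le⟩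
    exact hne s hs.1 hs'
  have hanti : StrictAntiOn L (Ici 0) := by
    apply strictAntiOn_of_deriv_neg (convex_Ici 0) hcont
    intro t ht
    rw [interior_Ici] at ht
    have ht : 0 < t := ht
    rw [(hL_ode t ht.le).deriv]
    have h := hgt t ht.le
    have h1 : 1 < L t / M := (one_lt_div hM).2 h
    have h2 : 1 < L t / N := (one_lt_div hN).2 (hNM.trans h)
    have h0 : 0 < r * L t := mul_pos hr (hM.trans h)
    exact mul_neg_of_neg_of_pos (mul_neg_of_pos_of_neg h0 (by linarith)) (by linarith)
  have hlim : Tendsto L atTop (nhds M) := by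
    set c := r * (M / N - 1) with hc
    have hcpos : 0 < c := mul_pos hr (by have := (one_lt_div hN).2 hNM; linarith)
    have hd : ∀ t ≥ (0:ℝ), HasDerivAt (fun t => (L t - M) * Real.exp (c * t))
        ((c - r * (L t / M) * (L t / N - 1)) * ((L t - M) * Real.exp (c * t))) t := by
      intro t ht
      have h1 := ((hL_ode t ht).sub_const M)
      have h2 := (((hasDerivAt_id t).const_mul c)).exp
      refine (h1.mul h2).congr_deriv ?_
      simp only [id, Pi.pow_apply, Nat.cast_ofNat, mul_one]
      field_simp
      ring
    have hmono : AntitoneOn (fun t => (L t - M) * Real.exp (c * t)) (Ici 0) := by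
      apply antitoneOn_of_deriv_nonpos (convex_Ici 0)
      · exact fun t ht => (hd t ht).continuousAt.continuousWithinAt
      · intro t ht
        rw [interior_Ici] at ht
        exact (hd t (le_of_lt ht)).differentiableAt.differentiableWithinAt
      · intro t ht
        rw [interior_Ici] at ht
        have ht : 0 ≤ t := le_of_lt ht
        rw [(hd t ht).deriv]
        have h := hgt t ht
        have h1 : 1 < L t / M := (one_lt_div hM).2 h
        have h2 : 1 < M / N := (one_lt_div hN).2 hNM
        have h3 : M / N < L t / N := by gcongr
        apply mul_nonpos_of_nonpos_of_nonneg
        · have : M / N - 1 ≤ (L t / M) * (L t / N - 1) := by nlinarith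
          rw [hc, mul_assoc]
          nlinarith
        · exact mul_nonneg (by linarith) (Real.exp_pos _).le
    have hup : Tendsto (fun t : ℝ => M + (L₀ - M) * Real.exp (-(c * t))) atTop (nhds M) := by
      have h1 : Tendsto (fun t : ℝ => Real.exp (-(c * t))) atTop (nhds 0) :=
        Real.tendsto_exp_neg_atTop_nhds_zero.comp (tendsto_id.const_mul_atTop hcpos)
      simpa using (h1.const_mul (L₀ - M)).const_add M
    refine tendsto_of_tendsto_of_tendsto_of_le_of_le' tendsto_const_nhds hup ?_ ?_
    · filter_upwards [eventually_ge_atTop 0] with t ht using (hgt t ht).le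
    · filter_upwards [eventually_ge_atTop 0] with t ht
      have h := hmono self_mem_Ici ht ht
      simp only [hL_init, mul_zero, Real.exp_zero, mul_one] at h
      have := mul_le_mul_of_nonneg_right h (Real.exp_pos (-(c * t))).le
      rw [mul_assoc, ← Real.exp_add, add_neg_cancel, Real.exp_zero, mul_one] at this
      linarith
  have hnmono : StrictMonoOn n (Ici 0) := by
    intro s hs t ht hst
    have h := hanti hs ht hst
    have hgs := hgt s hs
    have hg := hgt t ht
    rw [hn_def, hn_def, mul_assoc, mul_assoc]
    apply mul_lt_mul_of_pos_left _ hr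
    have h1 : 1 < L t / M := (one_lt_div hM).2 hg
    have h2 : 1 < L t / N := (one_lt_div hN).2 (hNM.trans hg)
    have h3 : L t / M < L s / M := by gcongr
    have h4 : L t / N < L s / N := by gcongr
    nlinarith
  refine ⟨hgt, hanti, hlim, ?_, ?_, hnmono, ?_⟩
  · intro t ht
    refine ⟨hnmono.monotoneOn self_mem_Ici ht ht, ?_⟩
    have h := hgt t ht
    have h1 : 1 < L t / M := (one_lt_div hM).2 h
    have h2 : 1 < L t / N := (one_lt_div hN).2 (hNM.trans h)
    rw [hn_def]
    exact mul_neg_of_neg_of_pos (mul_neg_of_pos_of_neg hr (by linarith)) (by linarith)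
  · intro t ht
    exact hnmono self_mem_Ici (le_of_lt ht : (0:ℝ) ≤ t) ht
  · have h : Tendsto (fun t => r * (1 - L t / M) * (L t / N - 1)) atTop
        (nhds (r * (1 - M / M) * (M / N - 1))) :=
      (((hlim.div_const M).const_sub 1).const_mul r).mul ((hlim.div_const N).sub_const 1)
    rw [div_self hM.ne'] at h
    rw [funext hn_def]
    simpa using h
end

section
/- For every initial value L₀ > 0 there exists η > 0 such that the population growth rate satisfies |n(t)| ≤ η for all t ≥ 0; in particular, if 0 < L₀ < N one may take η = r. -/
open Set Filter Real

lemma allee_lin (y a : ℝ → ℝ) (ha : ContinuousOn a (Ici 0))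
    (hy : ∀ t ≥ (0:ℝ), HasDerivAt y (a t * y t) t) (h0 : 0 ≤ y 0) :
    ∀ t ≥ (0:ℝ), 0 ≤ y t := by
  intro T hT
  have hb : Continuous (fun t : ℝ => a (max t 0)) :=
    ha.comp_continuous (by fun_prop) (fun t => le_max_right t 0)
  have hA : ∀ t, HasDerivAt (fun t => ∫ s in (0:ℝ)..t, a (max s 0)) (a (max t 0)) t :=
    fun t => hb.integral_hasStrictDerivAt 0 t |>.hasDerivAt
  set A : ℝ → ℝ := fun t => ∫ s in (0:ℝ)..t, a (max s 0) with hAdef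
  have hg : ∀ t ≥ (0:ℝ), HasDerivAt (fun t => y t * exp (-A t)) 0 t := by
    intro t ht
    have h := (hy t ht).mul ((hA t).neg.exp)
    have e : max t 0 = t := max_eq_left ht
    rw [e] at h
    refine HasDerivAt.congr_deriv h ?_
    simp only [Pi.neg_apply]
    ring
  have hc := constant_of_has_deriv_right_zero (f := fun t => y t * exp (-A t)) (a := 0) (b := T)
    (fun t ht => (hg t ht.1).continuousAt.continuousWithinAt)
    (fun t ht => (hg t ht.1).hasDerivWithinAt) T ⟨hT, le_rfl⟩
  have hA0 : A 0 = 0 := by simp [hAdef]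
  simp only [hA0, neg_zero, exp_zero, mul_one] at hc
  rw [← hc] at h0
  exact nonneg_of_mul_nonneg_left h0 (exp_pos _)

/-- Boundedness of the Allee-effect population growth rate: for every initial value
`L₀ > 0` the growth rate `n(t) = r·(1 − L/M)·(L/N − 1)` is bounded in absolute value by
some `η > 0` for all `t ≥ 0`; in particular, if `0 < L₀ < N` one may take `η = r`. -/
theorem allee_growth_rate_bounded
    (r N M : ℝ) (hr : r > 0) (hN : 0 < N) (hNM : N < M)
    (L : ℝ → ℝ) (L₀ : ℝ) (hL₀ : L₀ > 0)
    (hL_init : L 0 = L₀)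
    (hL_ode : ∀ t ≥ (0:ℝ),
      HasDerivAt L (r * L t * (1 - L t / M) * (L t / N - 1)) t)
    (n : ℝ → ℝ)
    (hn_def : ∀ t, n t = r * (1 - L t / M) * (L t / N - 1)) :
    (∃ η > (0:ℝ), ∀ t ≥ (0:ℝ), |n t| ≤ η) ∧
    (L₀ < N → ∀ t ≥ (0:ℝ), |n t| ≤ r) := by
  have hM : 0 < M := hN.trans hNM
  have hLc : ContinuousOn L (Ici 0) :=
    fun t ht => (hL_ode t ht).continuousAt.continuousWithinAt
  have hpos : ∀ t ≥ (0:ℝ), 0 ≤ L t := by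
    refine allee_lin L (fun t => r * (1 - L t / M) * (L t / N - 1)) (by fun_prop) ?_
      (by rw [hL_init]; exact hL₀.le)
    intro t ht
    convert hL_ode t ht using 1
    ring
  have hupM : L₀ ≤ M → ∀ t ≥ (0:ℝ), 0 ≤ M - L t := by
    intro h
    refine allee_lin (fun t => M - L t) (fun t => - (r * L t * (L t / N - 1) / M))
      (by fun_prop) ?_ (by simp only [hL_init]; linarith)
    intro t ht
    refine HasDerivAt.congr_deriv ((hL_ode t ht).const_sub M) ?_
    field_simp
  have hloM : M ≤ L₀ → ∀ t ≥ (0:ℝ), 0 ≤ L t - M := by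
    intro h
    refine allee_lin (fun t => L t - M) (fun t => - (r * L t * (L t / N - 1) / M))
      (by fun_prop) ?_ (by simp only [hL_init]; linarith)
    intro t ht
    refine HasDerivAt.congr_deriv ((hL_ode t ht).sub_const M) ?_
    field_simp
    ring
  have hupN : L₀ < N → ∀ t ≥ (0:ℝ), 0 ≤ N - L t := by
    intro h
    refine allee_lin (fun t => N - L t) (fun t => r * L t * (1 - L t / M) / N)
      (by fun_prop) ?_ (by simp only [hL_init]; linarith)
    intro t ht
    refine HasDerivAt.congr_deriv ((hL_ode t ht).const_sub N) ?_
    field_simp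
    ring
  have hB : ∃ B, ∀ t ≥ (0:ℝ), L t ≤ B := by
    rcases le_total L₀ M with h | h
    · exact ⟨M, fun t ht => by linarith [hupM h t ht]⟩
    · refine ⟨L₀, fun t ht => ?_⟩
      have hanti : AntitoneOn L (Ici 0) := by
        refine antitoneOn_of_deriv_nonpos (convex_Ici 0) hLc ?_ ?_
        · intro x hx
          rw [interior_Ici] at hx
          exact (hL_ode x (le_of_lt hx)).differentiableAt.differentiableWithinAt
        · intro x hx
          rw [interior_Ici] at hx
          have hx' : 0 ≤ x := le_of_lt hx
          rw [(hL_ode x hx').deriv]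
          have h1 := hloM h x hx'
          have h2 : 1 ≤ L x / M := by rw [le_div_iff₀ hM]; linarith
          have h3 : 1 ≤ L x / N := by rw [le_div_iff₀ hN]; linarith
          have h4 := hpos x hx'
          exact mul_nonpos_of_nonpos_of_nonneg
            (mul_nonpos_of_nonneg_of_nonpos (by positivity) (by linarith)) (by linarith)
      have := hanti (mem_Ici.2 le_rfl) (mem_Ici.2 ht) ht
      rwa [hL_init] at this
  constructor
  · obtain ⟨B, hB⟩ := hB
    have hB0 : 0 ≤ B := (hpos 0 le_rfl).trans (hB 0 le_rfl)
    refine ⟨r * (1 + B / M) * (B / N + 1), by positivity, fun t ht => ?_⟩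
    have h0 := hpos t ht
    have h1 := hB t ht
    have hm : L t / M ≤ B / M := by gcongr
    have hn : L t / N ≤ B / N := by gcongr
    have hm0 : 0 ≤ L t / M := by positivity
    have hn0 : 0 ≤ L t / N := by positivity
    rw [hn_def, abs_mul, abs_mul, abs_of_pos hr]
    have e1 : |1 - L t / M| ≤ 1 + B / M := by rw [abs_le]; constructor <;> linarith
    have e2 : |L t / N - 1| ≤ B / N + 1 := by rw [abs_le]; constructor <;> linarith
    gcongr
  · intro h t ht
    have h0 := hpos t ht
    have h1 := hupN h t ht
    have hm : L t / M ≤ 1 := by rw [div_le_one hM]; linarith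
    have hn : L t / N ≤ 1 := by rw [div_le_one hN]; linarith
    have hm0 : 0 ≤ L t / M := by positivity
    have hn0 : 0 ≤ L t / N := by positivity
    rw [hn_def, abs_mul, abs_mul, abs_of_pos hr]
    have e1 : |1 - L t / M| ≤ 1 := by rw [abs_le]; constructor <;> linarith
    have e2 : |L t / N - 1| ≤ 1 := by rw [abs_le]; constructor <;> linarith
    calc r * |1 - L t / M| * |L t / N - 1| ≤ r * 1 * 1 := by gcongr
      _ = r := by ring
end

section
/- For the Cobb–Douglas production function f(k) = k^α with 0 < α < 1, the function h(k) := f(k)/k − f'(k) = (1 − α)·k^{α−1} is strictly decreasing on (0,∞). Consequently, for any ρ > 0 and δ > r > 0, setting k₁ = (α/(ρ+δ−r))^{1/(1−α)} and k₂ = (α/(ρ+δ))^{1/(1−α)} (so that f'(k₁) = ρ+δ−r and f'(k₂) = ρ+δ), one has D_x := h(k₁) − h(k₂) < 0: the steady-state consumption-to-capital ratio is strictly lower under a diminishing population (limiting growth rate −r) than under a stagnating one (limiting growth rate 0). -/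
open Set Filter Real

/-- Cobb–Douglas case: for `f(k) = k^α` with `0 < α < 1`, the function
`h(k) = f(k)/k − f'(k) = (1−α)·k^{α−1}` is strictly decreasing on `(0,∞)`; hence for
the steady-state capitals `k₁ = (α/(ρ+δ−r))^{1/(1−α)}` and `k₂ = (α/(ρ+δ))^{1/(1−α)}`
(satisfying `f'(k₁) = ρ+δ−r`, `f'(k₂) = ρ+δ`) the difference of the steady-state
consumption-to-capital ratios is negative: `D_x = h(k₁) − h(k₂) < 0`. -/
theorem cobb_douglas_ratio_difference_negative
    (α ρ δ r : ℝ) (hα0 : 0 < α) (hα1 : α < 1)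
    (hρ : ρ > 0) (hr : r > 0) (hδr : δ > r)
    (f : ℝ → ℝ) (hf_def : ∀ k, f k = k ^ α)
    (h : ℝ → ℝ) (hh_def : ∀ k, h k = f k / k - deriv f k)
    (k₁ k₂ : ℝ)
    (hk₁_def : k₁ = (α / (ρ + δ - r)) ^ ((1:ℝ) / (1 - α)))
    (hk₂_def : k₂ = (α / (ρ + δ)) ^ ((1:ℝ) / (1 - α))) :
    (∀ k > (0:ℝ), h k = (1 - α) * k ^ (α - 1)) ∧
    StrictAntiOn h (Ioi 0) ∧
    deriv f k₁ = ρ + δ - r ∧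
    deriv f k₂ = ρ + δ ∧
    h k₁ - h k₂ < 0 := by
  have hfe : f = fun k => k ^ α := funext hf_def
  have hd : ∀ k > (0:ℝ), deriv f k = α * k ^ (α - 1) := by
    intro k hk
    rw [hfe]
    exact (Real.hasDerivAt_rpow_const (Or.inl hk.ne')).deriv
  have hform : ∀ k > (0:ℝ), h k = (1 - α) * k ^ (α - 1) := by
    intro k hk
    rw [hh_def, hd k hk, hf_def, Real.rpow_sub_one hk.ne']
    ring
  have hanti : StrictAntiOn h (Ioi 0) := by
    intro a ha b hb hab
    rw [hform a ha, hform b hb]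
    exact mul_lt_mul_of_pos_left
      (Real.rpow_lt_rpow_of_neg ha hab (by linarith)) (by linarith)
  have key : ∀ c > (0:ℝ), deriv f ((α / c) ^ ((1:ℝ) / (1 - α))) = c := by
    intro c hc
    have hq : 0 < α / c := div_pos hα0 hc
    have h1 : (1 - α) ≠ 0 := by linarith
    have he : (1:ℝ) / (1 - α) * (α - 1) = -1 := by
      field_simp
      ring
    rw [hd _ (Real.rpow_pos_of_pos hq _), ← Real.rpow_mul hq.le, he, Real.rpow_neg_one]
    field_simp
  have hc1 : 0 < ρ + δ - r := by linarith
  have hc2 : 0 < ρ + δ := by linarith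
  have hp1 : 0 < k₁ := hk₁_def ▸ Real.rpow_pos_of_pos (div_pos hα0 hc1) _
  have hp2 : 0 < k₂ := hk₂_def ▸ Real.rpow_pos_of_pos (div_pos hα0 hc2) _
  have hlt : k₂ < k₁ := by
    rw [hk₁_def, hk₂_def]
    refine Real.rpow_lt_rpow (div_pos hα0 hc2).le ?_ (one_div_pos.mpr (by linarith))
    exact div_lt_div_of_pos_left hα0 hc1 (by linarith)
  exact ⟨hform, hanti, hk₁_def ▸ key _ hc1, hk₂_def ▸ key _ hc2,
    sub_neg.mpr (hanti hp2 hp1 hlt)⟩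
end

section
/- For the logarithmic production function f(k) = ln(1+k), define h(k) := f(k)/k − f'(k) = ln(1+k)/k − 1/(1+k) for k > 0. Then the derivative h'(k) = (k/(1+k) − ln(1+k))/k² + 1/(1+k)² has a unique zero k* on (0,∞), with 2.16 < k* < 2.17; moreover h is strictly increasing on (0, k*) and strictly decreasing on (k*, ∞). -/
open Set Filter Real

lemma aux_log316 : Real.log (1 + 2.16) < 1.15077 := by
  have h1 := Real.sum_range_le_log_div (x := 21/179) (by norm_num) (by norm_num) 3
  have h2 := Real.log_two_lt_d9
  have h3 : Real.log (1 + 2.16) = 2 * Real.log 2 - Real.log ((1 + 21/179) / (1 - 21/179)) := by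
    rw [show (2:ℝ) * Real.log 2 = Real.log (2 ^ 2) by rw [Real.log_pow]; norm_num,
      ← Real.log_div (by norm_num) (by norm_num)]
    norm_num
  rw [h3]
  norm_num [Finset.sum_range_succ] at h1 h2 ⊢
  linarith

lemma aux_log317 : 1.1533 < Real.log (1 + 2.17) := by
  have h1 := Real.log_div_le_sum_range_add (x := 83/717) (by norm_num) (by norm_num) 3
  have h2 := Real.log_two_gt_d9
  have h3 : Real.log (1 + 2.17) = 2 * Real.log 2 - Real.log ((1 + 83/717) / (1 - 83/717)) := by
    rw [show (2:ℝ) * Real.log 2 = Real.log (2 ^ 2) by rw [Real.log_pow]; norm_num,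
      ← Real.log_div (by norm_num) (by norm_num)]
    norm_num
  rw [h3]
  norm_num [Finset.sum_range_succ] at h1 h2 ⊢
  linarith

noncomputable def auxg (k : ℝ) : ℝ := k / (1 + k) + k ^ 2 / (1 + k) ^ 2 - Real.log (1 + k)

lemma auxg_deriv (k : ℝ) (hk : 0 ≤ k) : HasDerivAt auxg ((k - k ^ 2) / (1 + k) ^ 3) k := by
  have hne : 1 + k ≠ 0 := by positivity
  have h1 : HasDerivAt (fun k : ℝ => 1 + k) 1 k := (hasDerivAt_id k).const_add 1
  have := (((hasDerivAt_id k).fun_div h1 hne).fun_add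
    ((hasDerivAt_pow 2 k).fun_div (h1.fun_pow 2) (by positivity))).fun_sub (h1.log hne)
  refine this.congr_deriv ?_
  simp only [id]
  field_simp
  ring

lemma auxg_cont : ContinuousOn auxg (Ici 0) := fun k hk =>
  (auxg_deriv k hk).continuousAt.continuousWithinAt

lemma auxg_mono : StrictMonoOn auxg (Icc 0 1) := by
  refine strictMonoOn_of_deriv_pos (convex_Icc 0 1) (auxg_cont.mono fun x hx => hx.1) ?_
  intro x hx
  rw [interior_Icc] at hx
  obtain ⟨h0, h1⟩ := hx
  rw [(auxg_deriv x h0.le).deriv]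
  have : 0 < x - x ^ 2 := by nlinarith
  positivity

lemma auxg_anti : StrictAntiOn auxg (Ici 1) := by
  refine strictAntiOn_of_deriv_neg (convex_Ici 1)
    (auxg_cont.mono (Ici_subset_Ici.2 zero_le_one)) ?_
  intro x hx
  rw [interior_Ici] at hx
  have h1 : 1 < x := hx
  rw [(auxg_deriv x (by linarith)).deriv]
  have : x - x ^ 2 < 0 := by nlinarith
  exact div_neg_of_neg_of_pos this (by positivity)

/-- Logarithmic production function case: for `f(k) = ln(1+k)` and
`h(k) = ln(1+k)/k − 1/(1+k)`, the derivative
`h'(k) = (k/(1+k) − ln(1+k))/k² + 1/(1+k)²` has a unique zero `k*` in `(0,∞)` with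
`2.16 < k* < 2.17`; moreover `h` is strictly increasing on `(0,k*)` and strictly
decreasing on `(k*,∞)`. -/
theorem log_production_ratio_hump
    (h : ℝ → ℝ)
    (hh_def : ∀ k, h k = Real.log (1 + k) / k - 1 / (1 + k)) :
    (∀ k > (0:ℝ),
      deriv h k = (k / (1 + k) - Real.log (1 + k)) / k ^ 2 + 1 / (1 + k) ^ 2) ∧
    ∃ kstar : ℝ, 0 < kstar ∧ 2.16 < kstar ∧ kstar < 2.17 ∧
      (∀ k > (0:ℝ), deriv h k = 0 ↔ k = kstar) ∧
      StrictMonoOn h (Ioc 0 kstar) ∧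
      StrictAntiOn h (Ici kstar) := by
  have hd : ∀ k > (0:ℝ), HasDerivAt h
      ((k / (1 + k) - Real.log (1 + k)) / k ^ 2 + 1 / (1 + k) ^ 2) k := by
    intro k hk
    have hne : 1 + k ≠ 0 := by positivity
    have h1 : HasDerivAt (fun k : ℝ => 1 + k) 1 k := (hasDerivAt_id k).const_add 1
    have := ((h1.log hne).fun_div (hasDerivAt_id k) hk.ne').fun_sub
      ((hasDerivAt_const k (1:ℝ)).fun_div h1 hne)
    rw [show h = fun k => Real.log (1 + k) / k - 1 / (1 + k) from funext hh_def]
    refine this.congr_deriv ?_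
    simp only [id]
    field_simp
    ring
  have hdg : ∀ k > (0:ℝ), deriv h k = auxg k / k ^ 2 := by
    intro k hk
    rw [(hd k hk).deriv, auxg]
    have hne : 1 + k ≠ 0 := by positivity
    field_simp
    ring
  have hcont : ContinuousOn h (Ioi 0) := fun k hk =>
    (hd k hk).continuousAt.continuousWithinAt
  have ga : 0 < auxg 2.16 := by
    have := aux_log316
    unfold auxg
    norm_num at this ⊢
    linarith
  have gb : auxg 2.17 < 0 := by
    have := aux_log317
    unfold auxg
    norm_num at this ⊢
    linarith
  obtain ⟨s, ⟨hs1, hs2⟩, hs⟩ := intermediate_value_Ioo' (show (2.16:ℝ) ≤ 2.17 by norm_num)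
    (auxg_cont.mono fun x hx => le_trans (by norm_num) hx.1) ⟨gb, ga⟩
  have s1 : 1 < s := lt_trans (by norm_num) hs1
  have s0 : 0 < s := by linarith
  have g0 : auxg 0 = 0 := by simp [auxg]
  have gpos : ∀ k, 0 < k → k < s → 0 < auxg k := by
    intro k hk hks
    rcases le_total k 1 with h1 | h1
    · have := auxg_mono (show (0:ℝ) ∈ Icc 0 1 by simp) ⟨hk.le, h1⟩ hk
      linarith
    · have := auxg_anti (show k ∈ Ici 1 from h1) (show s ∈ Ici 1 from s1.le) hks
      linarith
  have gneg : ∀ k, s < k → auxg k < 0 := by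
    intro k hk
    have := auxg_anti (show s ∈ Ici 1 from s1.le) (show k ∈ Ici 1 from (s1.trans hk).le) hk
    linarith
  refine ⟨fun k hk => (hd k hk).deriv, s, s0, hs1, hs2, ?_, ?_, ?_⟩
  · intro k hk
    rw [hdg k hk]
    constructor
    · intro h0
      have hk2 : k ^ 2 ≠ 0 := by positivity
      have h0' : auxg k = 0 := by
        rcases div_eq_zero_iff.1 h0 with h | h
        · exact h
        · exact absurd h hk2
      rcases lt_trichotomy k s with h | h | h
      · exact absurd h0' (gpos k hk h).ne'
      · exact h
      · exact absurd h0' (gneg k h).ne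
    · rintro rfl
      rw [hs, zero_div]
  · refine strictMonoOn_of_deriv_pos (convex_Ioc 0 s) (hcont.mono fun x hx => hx.1) ?_
    intro x hx
    rw [interior_Ioc] at hx
    rw [hdg x hx.1]
    exact div_pos (gpos x hx.1 hx.2) (pow_pos hx.1 2)
  · refine strictAntiOn_of_deriv_neg (convex_Ici s)
      (hcont.mono fun x hx => lt_of_lt_of_le s0 hx) ?_
    intro x hx
    rw [interior_Ici] at hx
    have hx0 : 0 < x := s0.trans hx
    rw [hdg x hx0]
    exact div_neg_of_neg_of_pos (gneg x hx) (pow_pos hx0 2)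
end

section
/- For the constant-absolute-risk-aversion production function f(k) = 1 − e^{−k}, define h(k) := f(k)/k − f'(k) = (1 − e^{−k})/k − e^{−k} for k > 0. Then the derivative h'(k) = (k·e^{−k} − 1 + e^{−k})/k² + e^{−k} has a unique zero k* on (0,∞), with 1.79 < k* < 1.80; moreover h is strictly increasing on (0, k*) and strictly decreasing on (k*, ∞). -/
open Set Filter Real

noncomputable def gAux (k : ℝ) : ℝ := (k ^ 2 + k + 1) * Real.exp (-k) - 1

lemma gAux_hasDeriv (k : ℝ) : HasDerivAt gAux (k * (1 - k) * Real.exp (-k)) k := by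
  have h1 : HasDerivAt (fun x : ℝ => Real.exp (-x)) (Real.exp (-k) * (-1)) k :=
    (hasDerivAt_neg k).exp
  have h2 : HasDerivAt (fun x : ℝ => x ^ 2 + x + 1) (2 * k + 1) k := by
    simpa using (((hasDerivAt_pow 2 k).add (hasDerivAt_id k)).add_const (1 : ℝ))
  have h3 := (h2.mul h1).sub_const (1 : ℝ)
  have e : k * (1 - k) * Real.exp (-k)
      = (2 * k + 1) * Real.exp (-k) + (k ^ 2 + k + 1) * (Real.exp (-k) * (-1)) := by ring
  rw [e]
  exact h3

lemma gAux_cont : Continuous gAux :=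
  continuous_iff_continuousAt.2 fun k => (gAux_hasDeriv k).continuousAt

lemma gAux_mono : StrictMonoOn gAux (Icc 0 1) := by
  apply strictMonoOn_of_deriv_pos (convex_Icc 0 1) gAux_cont.continuousOn
  intro x hx
  rw [interior_Icc] at hx
  rw [(gAux_hasDeriv x).deriv]
  exact mul_pos (mul_pos hx.1 (by linarith [hx.2])) (Real.exp_pos _)

lemma gAux_anti : StrictAntiOn gAux (Ici 1) := by
  apply strictAntiOn_of_deriv_neg (convex_Ici 1) gAux_cont.continuousOn
  intro x hx
  rw [interior_Ici] at hx
  have hx' : 1 < x := hx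
  rw [(gAux_hasDeriv x).deriv]
  exact mul_neg_of_neg_of_pos (mul_neg_of_pos_of_neg (by linarith) (by linarith)) (Real.exp_pos _)

lemma exp_179 : Real.exp 1.79 < 5.9941 := by
  have h := Real.exp_bound' (x := 0.895) (by norm_num) (by norm_num) (n := 8) (by norm_num)
  have h2 : Real.exp 0.895 < 2.448 := by
    refine lt_of_le_of_lt h ?_
    norm_num [Finset.sum_range_succ, Nat.factorial]
  have e : Real.exp 1.79 = Real.exp 0.895 * Real.exp 0.895 := by
    rw [← Real.exp_add]; norm_num
  rw [e]
  nlinarith [Real.exp_pos 0.895]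

lemma exp_180 : 6.04 < Real.exp 1.80 := by
  have h := Real.sum_le_exp_of_nonneg (x := 1.80) (by norm_num) 12
  refine lt_of_lt_of_le ?_ h
  norm_num [Finset.sum_range_succ, Nat.factorial]

lemma gAux_179 : 0 < gAux 1.79 := by
  unfold gAux
  rw [Real.exp_neg, ← div_eq_mul_inv, sub_pos, lt_div_iff₀ (Real.exp_pos _)]
  have := exp_179
  norm_num at this ⊢
  linarith

lemma gAux_180 : gAux 1.80 < 0 := by
  unfold gAux
  rw [Real.exp_neg, ← div_eq_mul_inv, sub_neg, div_lt_iff₀ (Real.exp_pos _)]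
  have := exp_180
  norm_num at this ⊢
  linarith

/-- CARA production function case: for `f(k) = 1 − e^{−k}` and
`h(k) = (1 − e^{−k})/k − e^{−k}`, the derivative
`h'(k) = (k·e^{−k} − 1 + e^{−k})/k² + e^{−k}` has a unique zero `k*` in `(0,∞)` with
`1.79 < k* < 1.80`; moreover `h` is strictly increasing on `(0,k*)` and strictly
decreasing on `(k*,∞)`. -/
theorem cara_production_ratio_hump
    (h : ℝ → ℝ)
    (hh_def : ∀ k, h k = (1 - Real.exp (-k)) / k - Real.exp (-k)) :
    (∀ k > (0:ℝ),
      deriv h k = (k * Real.exp (-k) - 1 + Real.exp (-k)) / k ^ 2 + Real.exp (-k)) ∧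
    ∃ kstar : ℝ, 0 < kstar ∧ 1.79 < kstar ∧ kstar < 1.80 ∧
      (∀ k > (0:ℝ), deriv h k = 0 ↔ k = kstar) ∧
      StrictMonoOn h (Ioc 0 kstar) ∧
      StrictAntiOn h (Ici kstar) := by
  have hD : ∀ k > (0:ℝ), HasDerivAt h (gAux k / k ^ 2) k := by
    intro k hk
    have hf : h = fun k => (1 - Real.exp (-k)) / k - Real.exp (-k) := funext hh_def
    have h1 : HasDerivAt (fun x : ℝ => Real.exp (-x)) (Real.exp (-k) * (-1)) k :=
      (hasDerivAt_neg k).exp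
    have h3 := ((h1.const_sub 1).div (hasDerivAt_id k) hk.ne').sub h1
    rw [hf]
    refine h3.congr_deriv ?_
    have := hk.ne'
    simp only [gAux, id]
    field_simp
    ring
  obtain ⟨c, hc, hc0⟩ : ∃ c ∈ Icc (1.79:ℝ) 1.80, gAux c = 0 :=
    intermediate_value_Icc' (by norm_num) gAux_cont.continuousOn
      ⟨gAux_180.le, gAux_179.le⟩
  have hc1 : (1.79:ℝ) < c := lt_of_le_of_ne hc.1 (by
    rintro rfl; exact absurd hc0 gAux_179.ne')
  have hc2 : c < (1.80:ℝ) := lt_of_le_of_ne hc.2 (by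
    rintro rfl; exact absurd hc0 gAux_180.ne)
  have hc3 : (1:ℝ) < c := by norm_num at hc1; linarith
  have hpos : ∀ k, 0 < k → k < c → 0 < gAux k := by
    intro k hk hkc
    rcases le_total k 1 with h1 | h1
    · have := gAux_mono (a := 0) (b := k) ⟨le_rfl, zero_le_one⟩ ⟨hk.le, h1⟩ hk
      have e : gAux 0 = 0 := by simp [gAux]
      linarith
    · have := gAux_anti (a := k) (b := c) h1 hc3.le hkc
      linarith
  have hneg : ∀ k, c < k → gAux k < 0 := by
    intro k hk
    have := gAux_anti (a := c) (b := k) hc3.le (hc3.trans hk).le hk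
    linarith
  refine ⟨?_, c, by linarith, hc1, hc2, ?_, ?_, ?_⟩
  · intro k hk
    rw [(hD k hk).deriv]
    have := hk.ne'
    simp only [gAux]
    field_simp
    ring
  · intro k hk
    rw [(hD k hk).deriv]
    have hk2 : 0 < k ^ 2 := by positivity
    constructor
    · intro h0
      rcases lt_trichotomy k c with hl | hl | hl
      · exact absurd h0 (div_pos (hpos k hk hl) hk2).ne'
      · exact hl
      · exact absurd h0 (div_neg_of_neg_of_pos (hneg k hl) hk2).ne
    · rintro rfl
      simp [hc0]
  · apply strictMonoOn_of_deriv_pos (convex_Ioc 0 c)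
    · intro x hx
      exact (hD x hx.1).continuousAt.continuousWithinAt
    · intro x hx
      rw [interior_Ioc] at hx
      rw [(hD x hx.1).deriv]
      exact div_pos (hpos x hx.1 hx.2) (pow_pos hx.1 2)
  · apply strictAntiOn_of_deriv_neg (convex_Ici c)
    · intro x hx
      have hx' : c ≤ x := hx
      exact (hD x (by linarith)).continuousAt.continuousWithinAt
    · intro x hx
      rw [interior_Ici] at hx
      have hx' : c < x := hx
      have hx0 : 0 < x := by linarith
      rw [(hD x hx0).deriv]
      exact div_neg_of_neg_of_pos (hneg x hx') (pow_pos hx0 2)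
end
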